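/- Let β > 0, let (X, A_X) and (Y, A_Y) be finite networks, and let φ : X → Y be a dissimilarity reducing map, i.e., A_X(x,x') ≥ A_Y(φ(x), φ(x')) for all x, x' ∈ X. Define u^{R/R_max}(x,x';β) = u^{R}(x,x') if u^{R}(x,x') ≤ β, and max(β, u^{NR}(x,x')) otherwise. Then for all x, x' ∈ X, u^{R/R_max}_X(x,x';β) ≥ u^{R/R_max}_Y(φ(x),φ(x');β), i.e., the method H^{R/R_max}(β) satisfies the Axiom of Transformation. -/

import Mathlib

noncomputable section

/-- Cost of a chain (a finite ordered list of nodes): the maximum dissimilarity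
encountered over consecutive pairs (0 for chains with fewer than two nodes). -/
def chainCost {X : Type*} (A : X → X → ℝ) : List X → ℝ
  | [] => 0
  | [_] => 0
  | a :: b :: rest => max (A a b) (chainCost A (b :: rest))

/-- The set of costs of chains from `x` to `x'`. -/
def chainCosts {X : Type*} (A : X → X → ℝ) (x x' : X) : Set ℝ :=
  { c | ∃ l : List X, l.head? = some x ∧ l.getLast? = some x' ∧ chainCost A l = c }

/-- Directed minimum chain cost ũ*(x,x'). -/
def minChainCost {X : Type*} (A : X → X → ℝ) (x x' : X) : ℝ :=
  sInf (chainCosts A x x')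

/-- The reciprocal ultrametric u^R. -/
def uR {X : Type*} (A : X → X → ℝ) (x x' : X) : ℝ :=
  minChainCost (fun a b => max (A a b) (A b a)) x x'

/-- The nonreciprocal ultrametric u^NR. -/
def uNR {X : Type*} (A : X → X → ℝ) (x x' : X) : ℝ :=
  max (minChainCost A x x') (minChainCost A x' x)

/-- The set of costs of chains from `x` to `x'` having at most `t` nodes. -/
def boundedChainCosts {X : Type*} (A : X → X → ℝ) (t : ℕ) (x x' : X) : Set ℝ :=
  { c | ∃ l : List X, l.head? = some x ∧ l.getLast? = some x' ∧ l.length ≤ t ∧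
      chainCost A l = c }

/-- A^{SR(t)}(x,x'): minimum cost over chains from `x` to `x'` with at most `t` nodes. -/
def ASR {X : Type*} (A : X → X → ℝ) (t : ℕ) (x x' : X) : ℝ :=
  sInf (boundedChainCosts A t x x')

/-- The semi-reciprocal ultrametric u^{SR(t)}. -/
def uSR {X : Type*} (A : X → X → ℝ) (t : ℕ) (x x' : X) : ℝ :=
  minChainCost (fun a b => max (ASR A t a b) (ASR A t b a)) x x'

/-- The grafted function u^{R/R_max}(·,·;β). -/
def uRRmax {X : Type*} (A : X → X → ℝ) (β : ℝ) (x x' : X) : ℝ :=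
  if uR A x x' ≤ β then uR A x x' else max β (uNR A x x')

theorem chainCost_nonneg {X : Type*} (A : X → X → ℝ) : ∀ l : List X, 0 ≤ chainCost A l
  | [] => le_rfl
  | [_] => le_rfl
  | _ :: b :: rest => (chainCost_nonneg A (b :: rest)).trans (le_max_right _ _)

theorem chainCost_map_le {X Y : Type*} {A : X → X → ℝ} {B : Y → Y → ℝ} {φ : X → Y}
    (hφ : ∀ a b, B (φ a) (φ b) ≤ A a b) :
    ∀ l : List X, chainCost B (l.map φ) ≤ chainCost A l
  | [] => le_rfl
  | [_] => le_rfl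
  | a :: b :: rest => max_le_max (hφ a b) (chainCost_map_le hφ (b :: rest))

theorem chainCosts_nonempty {X : Type*} (A : X → X → ℝ) (x x' : X) :
    (chainCosts A x x').Nonempty :=
  ⟨_, [x, x'], rfl, rfl, rfl⟩

theorem bddBelow_chainCosts {X : Type*} (A : X → X → ℝ) (x x' : X) :
    BddBelow (chainCosts A x x') := by
  refine ⟨0, ?_⟩
  rintro _ ⟨l, -, -, rfl⟩
  exact chainCost_nonneg A l

theorem minChainCost_map_le {X Y : Type*} {A : X → X → ℝ} {B : Y → Y → ℝ} {φ : X → Y}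
    (hφ : ∀ a b, B (φ a) (φ b) ≤ A a b) (x x' : X) :
    minChainCost B (φ x) (φ x') ≤ minChainCost A x x' := by
  refine le_csInf (chainCosts_nonempty A x x') ?_
  rintro _ ⟨l, hx, hx', rfl⟩
  refine (csInf_le (bddBelow_chainCosts B _ _) ⟨l.map φ, ?_, ?_, rfl⟩).trans
    (chainCost_map_le hφ l)
  · simp [hx]
  · simp [hx']

theorem uR_map_le {X Y : Type*} {A : X → X → ℝ} {B : Y → Y → ℝ} {φ : X → Y}
    (hφ : ∀ a b, B (φ a) (φ b) ≤ A a b) (x x' : X) :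
    uR B (φ x) (φ x') ≤ uR A x x' :=
  minChainCost_map_le (A := fun a b => max (A a b) (A b a))
    (B := fun a b => max (B a b) (B b a)) (fun a b => max_le_max (hφ a b) (hφ b a)) x x'

theorem uNR_map_le {X Y : Type*} {A : X → X → ℝ} {B : Y → Y → ℝ} {φ : X → Y}
    (hφ : ∀ a b, B (φ a) (φ b) ≤ A a b) (x x' : X) :
    uNR B (φ x) (φ x') ≤ uNR A x x' :=
  max_le_max (minChainCost_map_le hφ x x') (minChainCost_map_le hφ x' x)

/-- the method H^{R/R_max}(β) satisfies the Axiom of Transformation: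
dissimilarity reducing maps do not increase the grafted ultrametrics. -/
theorem grafting_RRmax_axiom_of_transformation {X Y : Type*} [Fintype X] [Fintype Y]
    (AX : X → X → ℝ) (AY : Y → Y → ℝ)
    (hnonnegX : ∀ x x' : X, 0 ≤ AX x x')
    (hidX : ∀ x x' : X, AX x x' = 0 ↔ x = x')
    (hnonnegY : ∀ y y' : Y, 0 ≤ AY y y')
    (hidY : ∀ y y' : Y, AY y y' = 0 ↔ y = y')
    (β : ℝ) (hβ : 0 < β)
    (φ : X → Y) (hφ : ∀ x x' : X, AY (φ x) (φ x') ≤ AX x x') :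
    ∀ x x' : X, uRRmax AY β (φ x) (φ x') ≤ uRRmax AX β x x' := by
  intro x x'
  have hR := uR_map_le hφ x x'
  unfold uRRmax
  by_cases hX : uR AX x x' ≤ β
  · rwa [if_pos hX, if_pos (hR.trans hX)]
  · rw [if_neg hX]
    split_ifs with hY
    · exact hY.trans (le_max_left _ _)
    · exact max_le_max le_rfl (uNR_map_le hφ x x')
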